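/- arXiv:1511.08724 — 2 statements merged into one kernel-verified Lean document; each statement's English description precedes it below -/
import Mathlib

section
/- Let T = (Q, Q₀, A, rewards, δ) be a reducible task and let R be a fair run on T. Then every state q ∈ Q eventually becomes stable in R, i.e., there are only finitely many non-terminal occurrences of branching configurations containing q. -/
/-!
Formalization of the navigational reinforcement learning framework of
Ameloot & Van den Bussche, "On the convergence of cycle detection for
navigational reinforcement learning".
-/

/-- A task `T = (Q, Q₀, A, rewards, δ)`: `Q` and `A` are (finite, nonempty) types,
`start` is a nonempty set of start states, `rewards` a nonempty set of
state-action pairs and `delta` maps each state-action pair to a nonempty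
set of successor states. -/
structure NavTask (Q A : Type) where
  start : Set Q
  start_nonempty : start.Nonempty
  rewards : Set (Q × A)
  rewards_nonempty : rewards.Nonempty
  delta : Q → A → Set Q
  delta_nonempty : ∀ q a, (delta q a).Nonempty

namespace NavTask

variable {Q A : Type}

/-- The goal states of a task. -/
def goals (T : NavTask Q A) : Set Q := {q | ∃ a, (q, a) ∈ T.rewards}

/-- The reducibility layers relative to a set `S`; `layers S 0` is the layer `F₁ = S`
of the paper, and `layers S n` is the layer `F_{n+1}`. -/
def layers (T : NavTask Q A) (S : Set Q) : ℕ → Set Q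
  | 0 => S
  | n + 1 => T.layers S n ∪ {q | ∃ a, T.delta q a ⊆ T.layers S n}

/-- `S'` is reducible to `S`. -/
def ReducibleTo (T : NavTask Q A) (S' S : Set Q) : Prop := S' ⊆ ⋃ n, T.layers S n

/-- `reduce T`: the set of states reducible to the goal states. -/
def reduce (T : NavTask Q A) : Set Q := ⋃ n, T.layers T.goals n

/-- A task is reducible if all states are reducible to the goal states. -/
def Reducible (T : NavTask Q A) : Prop := T.ReducibleTo Set.univ T.goals

end NavTask

/-- A configuration `(q, π, V)`: current state, policy, working memory. -/
structure Config (Q A : Type) where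
  state : Q
  pol : Q → A
  mem : Set Q

namespace Config

variable {Q A : Type}

/-- A configuration is branching if its current state has already been visited. -/
def Branching (c : Config Q A) : Prop := c.state ∈ c.mem

/-- Applying an option `(a, q')` to a configuration: move to `q'`, record action `a`
for the departed state, and mark the departed state as visited. -/
noncomputable def apply (c : Config Q A) (a : A) (q' : Q) : Config Q A :=
  letI := Classical.decEq Q
  ⟨q', Function.update c.pol c.state a, c.mem ∪ {c.state}⟩

end Config

/-- A transition: a four-tuple (source configuration, action, chosen successor
state, target configuration). -/
structure Step (Q A : Type) where
  src : Config Q A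
  act : A
  nxt : Q
  tgt : Config Q A

namespace NavTask

variable {Q A : Type}

/-- The options of a configuration: all actions if branching, otherwise only
the action given by the policy, paired with possible successor states. -/
def opts (T : NavTask Q A) (c : Config Q A) : Set (A × Q) :=
  {p | (c.Branching ∨ p.1 = c.pol c.state) ∧ p.2 ∈ T.delta c.state p.1}

/-- Validity of a transition. -/
def ValidStep (T : NavTask Q A) (t : Step Q A) : Prop :=
  (t.act, t.nxt) ∈ T.opts t.src ∧ t.tgt = t.src.apply t.act t.nxt

/-- A reward transition. -/
def IsRewardStep (T : NavTask Q A) (t : Step Q A) : Prop :=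
  (t.src.state, t.act) ∈ T.rewards

end NavTask

/-- A finite list of transitions is a chain: each target is the next source. -/
def IsChainList {Q A : Type} (l : List (Step Q A)) : Prop :=
  ∀ i (h : i + 1 < l.length),
    (l[i]'(Nat.lt_of_succ_lt h)).tgt = (l[i + 1]'h).src

/-- The first (source) configuration of a finite chain, if any. -/
def firstSrc? {Q A : Type} (l : List (Step Q A)) : Option (Config Q A) :=
  l.head?.map Step.src

/-- The last (target, i.e. terminal) configuration of a finite chain, if any. -/
def lastTgt? {Q A : Type} (l : List (Step Q A)) : Option (Config Q A) :=
  l.getLast?.map Step.tgt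

namespace NavTask

variable {Q A : Type}

/-- A finite trial: a nonempty valid chain ending with a reward transition and
containing no other reward transitions. -/
def IsFinTrial (T : NavTask Q A) (l : List (Step Q A)) : Prop :=
  l ≠ [] ∧ IsChainList l ∧ (∀ t ∈ l, T.ValidStep t) ∧
  (∀ t ∈ l.getLast?, T.IsRewardStep t) ∧
  (∀ i (h : i + 1 < l.length), ¬ T.IsRewardStep (l[i]'(Nat.lt_of_succ_lt h)))

/-- An infinite trial: an infinite valid chain with no reward transitions. -/
def IsInfTrial (T : NavTask Q A) (g : ℕ → Step Q A) : Prop :=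
  (∀ n, T.ValidStep (g n)) ∧ (∀ n, (g n).tgt = (g (n + 1)).src) ∧
  (∀ n, ¬ T.IsRewardStep (g n))

/-- A start configuration: a start state with empty working memory. -/
def IsStartConfig (T : NavTask Q A) (c : Config Q A) : Prop :=
  c.state ∈ T.start ∧ c.mem = ∅

/-- When a trial ends with `c₁`, the next trial starts with a configuration `c₂`
whose state is a start state, with the same policy, and empty working memory. -/
def Succession (T : NavTask Q A) (c₁ c₂ : Config Q A) : Prop :=
  c₂.state ∈ T.start ∧ c₂.pol = c₁.pol ∧ c₂.mem = ∅

end NavTask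

/-- A trial is either a finite or an infinite chain of transitions. -/
inductive Trial (Q A : Type) where
  | fin : List (Step Q A) → Trial Q A
  | inf : (ℕ → Step Q A) → Trial Q A

namespace Trial

variable {Q A : Type}

/-- A trial is finite (terminates). -/
def IsFinite : Trial Q A → Prop
  | .fin _ => True
  | .inf _ => False

/-- The configuration occurring at (0-based) position `n` of a trial: sources of
the transitions, plus (for a finite trial) the terminal configuration. -/
def config? : Trial Q A → ℕ → Option (Config Q A)
  | .fin l, n =>
      if h : n < l.length then some (l[n]'h).src
      else if n = l.length then lastTgt? l else none
  | .inf g, n => some (g n).src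

/-- Position `n` of a trial is non-terminal. -/
def NonTerminal : Trial Q A → ℕ → Prop
  | .fin l, n => n < l.length
  | .inf _, _ => True

/-- The positions at which state `q` occurs in a trial. -/
def stateOccs (tr : Trial Q A) (q : Q) : Set ℕ :=
  {n | ∃ c ∈ tr.config? n, c.state = q}

end Trial

/-- Validity of a trial. -/
def NavTask.IsTrial {Q A : Type} (T : NavTask Q A) : Trial Q A → Prop
  | .fin l => T.IsFinTrial l
  | .inf g => T.IsInfTrial g

/-- A run: either an infinite sequence of finite trials, or finitely many finite
trials followed by one infinite trial. -/
inductive Run (Q A : Type) where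
  | allFin : (ℕ → List (Step Q A)) → Run Q A
  | withInf : List (List (Step Q A)) → (ℕ → Step Q A) → Run Q A

/-- Validity of a run on a task. -/
def NavTask.IsRun {Q A : Type} (T : NavTask Q A) : Run Q A → Prop
  | .allFin f =>
      (∀ n, T.IsFinTrial (f n)) ∧
      (∀ c ∈ firstSrc? (f 0), T.IsStartConfig c) ∧
      (∀ n, ∀ c₁ ∈ lastTgt? (f n), ∀ c₂ ∈ firstSrc? (f (n + 1)), T.Succession c₁ c₂) ∧
      (∀ q ∈ T.start, {n | ∃ c ∈ firstSrc? (f n), c.state = q}.Infinite)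
  | .withInf L g =>
      (∀ l ∈ L, T.IsFinTrial l) ∧ T.IsInfTrial g ∧
      (L = [] → T.IsStartConfig (g 0).src) ∧
      (∀ l ∈ L.head?, ∀ c ∈ firstSrc? l, T.IsStartConfig c) ∧
      (∀ i (h : i + 1 < L.length),
        ∀ c₁ ∈ lastTgt? (L[i]'(Nat.lt_of_succ_lt h)),
        ∀ c₂ ∈ firstSrc? (L[i + 1]'h), T.Succession c₁ c₂) ∧
      (∀ c₁ ∈ lastTgt? (L.getLast?.getD []), T.Succession c₁ (g 0).src)

namespace Run

variable {Q A : Type}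

/-- The trials of a run. -/
def trials : Run Q A → Set (Trial Q A)
  | .allFin f => {tr | ∃ n, tr = .fin (f n)}
  | .withInf L g => {tr | (∃ l ∈ L, tr = .fin l) ∨ tr = .inf g}

/-- `P` holds at infinitely many transitions (equivalently, non-terminal
configuration occurrences) of the run, restricted to trials of index `≥ i`. -/
def InfOftenFrom : Run Q A → ℕ → (Step Q A → Prop) → Prop
  | .allFin f, i, P =>
      {p : ℕ × ℕ | i ≤ p.1 ∧ ∃ h : p.2 < (f p.1).length, P ((f p.1)[p.2]'h)}.Infinite
  | .withInf L g, i, P => i ≤ L.length ∧ {n | P (g n)}.Infinite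

/-- `P` holds at infinitely many transitions of the run. -/
def InfOften (R : Run Q A) (P : Step Q A → Prop) : Prop := R.InfOftenFrom 0 P

/-- A state is stable: only finitely many non-terminal occurrences of branching
configurations containing it. -/
def Stable (R : Run Q A) (q : Q) : Prop :=
  ¬ R.InfOften (fun t => t.src.state = q ∧ t.src.Branching)

/-- All trials of the run are finite. -/
def AllFinite : Run Q A → Prop
  | .allFin _ => True
  | .withInf _ _ => False

/-- A run converges: all trials terminate (with reward) and every state
eventually becomes stable. -/
def Converges (R : Run Q A) : Prop := R.AllFinite ∧ ∀ q, R.Stable q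

/-- Only finitely many trials contain more than `k` non-terminal configurations;
equivalently, from some trial index on, every trial has at most `k`
non-terminal configurations (sources of transitions). -/
def EventuallyBounded : Run Q A → ℕ → Prop
  | .allFin f, k => {n | k < (f n).length}.Finite
  | .withInf _ _, _ => False

/-- After trial `i` there are no more branching configurations at
non-terminal positions. -/
def NoBranchingAfter : Run Q A → ℕ → Prop
  | .allFin f, i => ∀ m, i < m → ∀ t ∈ f m, ¬ t.src.Branching
  | .withInf L g, i =>
      (∀ m, i < m → ∀ l ∈ L[m]?, ∀ t ∈ l, ¬ t.src.Branching) ∧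
      (i < L.length → ∀ n, ¬ (g n).src.Branching)

/-- Trial `i` of the run terminates (is finite). -/
def TrialTerminates : Run Q A → ℕ → Prop
  | .allFin _, _ => True
  | .withInf L _, i => i < L.length

/-- `i` is the convergence-trial index: the smallest trial index such that trial `i`
terminates and after trial `i` there are no branching configurations at
non-terminal positions. -/
def IsConvIndex (R : Run Q A) (i : ℕ) : Prop :=
  R.TrialTerminates i ∧ R.NoBranchingAfter i ∧
  ∀ j < i, ¬ (R.TrialTerminates j ∧ R.NoBranchingAfter j)

/-- `π` is the policy at the end of trial `i` of the run. -/
def EndPolicyAt : Run Q A → ℕ → (Q → A) → Prop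
  | .allFin f, i, π => ∃ t ∈ (f i).getLast?, t.tgt.pol = π
  | .withInf L _, i, π => ∃ l ∈ L[i]?, ∃ t ∈ l.getLast?, t.tgt.pol = π

/-- `π` is the final policy of the run: the policy at the end of the
convergence-trial. -/
def IsFinalPolicy (R : Run Q A) (π : Q → A) : Prop :=
  ∃ i, R.IsConvIndex i ∧ R.EndPolicyAt i π

/-- `π` occurs in the run at the end of some trial. -/
def EndsPolicy (R : Run Q A) (π : Q → A) : Prop := ∃ i, R.EndPolicyAt i π

end Run

namespace NavTask

variable {Q A : Type}

/-- Fairness: every configuration occurring infinitely often at non-terminal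
positions has each of its options taken infinitely often. -/
def Fair (T : NavTask Q A) (R : Run Q A) : Prop :=
  ∀ c : Config Q A, R.InfOften (fun t => t.src = c) →
    ∀ p ∈ T.opts c,
      R.InfOften (fun t => t = ⟨c, p.1, p.2, c.apply p.1 p.2⟩)

/-- A task is learnable under fairness if every fair run on it converges. -/
def Learnable (T : NavTask Q A) : Prop :=
  ∀ R : Run Q A, T.IsRun R → T.Fair R → R.Converges

/-- `ground π`: goal states assigned a rewarding action by the policy. -/
def ground (T : NavTask Q A) (π : Q → A) : Set Q := {q | (q, π q) ∈ T.rewards}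

/-- The forward layers of a policy; `fwd π 0` is `F₁ = Q₀` of the paper. -/
def fwd (T : NavTask Q A) (π : Q → A) : ℕ → Set Q
  | 0 => T.start
  | n + 1 => T.fwd π n ∪ ⋃ q ∈ T.fwd π n \ T.ground π, T.delta q (π q)

/-- `forward π`: states reachable from the start states by following `π`. -/
def forward (T : NavTask Q A) (π : Q → A) : Set Q := ⋃ n, T.fwd π n

/-- The backward layers of a policy; `bwd π 0` is `B₁ = ground(π)` of the paper. -/
def bwd (T : NavTask Q A) (π : Q → A) : ℕ → Set Q
  | 0 => T.ground π
  | n + 1 => T.bwd π n ∪ {q | T.delta q (π q) ⊆ T.bwd π n}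

/-- `backward π`: states reduced by `π` to the goal states in `ground π`. -/
def backward (T : NavTask Q A) (π : Q → A) : Set Q := ⋃ n, T.bwd π n

/-- A (simple) path from `q` to `q'`: non-reward transitions, pairwise distinct
states. -/
def Path (T : NavTask Q A) (q q' : Q) : Prop :=
  ∃ (n : ℕ) (s : ℕ → Q) (a : ℕ → A),
    s 0 = q ∧ s n = q' ∧
    (∀ i < n, s (i + 1) ∈ T.delta (s i) (a i)) ∧
    (∀ i < n, (s i, a i) ∉ T.rewards) ∧
    (∀ i ≤ n, ∀ j ≤ n, i ≠ j → s i ≠ s j)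

/-- A state is reachable: there is a path from some start state to it. -/
def Reachable (T : NavTask Q A) (q : Q) : Prop := ∃ q₀ ∈ T.start, T.Path q₀ q

/-- A state has a path to a set `S`. -/
def HasPathTo (T : NavTask Q A) (q : Q) (S : Set Q) : Prop := ∃ q' ∈ S, T.Path q q'

end NavTask

open Filter

theorem Config.apply_pol_self {Q A : Type} (c : Config Q A) (a : A) (q : Q) :
    (c.apply a q).pol c.state = a := by
  simp [Config.apply]

theorem Config.apply_pol_of_ne {Q A : Type} (c : Config Q A) (a : A) (q : Q) {r : Q}
    (h : r ≠ c.state) : (c.apply a q).pol r = c.pol r := by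
  simp [Config.apply, h]

instance Config.instFinite {Q A : Type} [Finite Q] [Finite A] : Finite (Config Q A) :=
  Finite.of_injective (fun c : Config Q A => (c.state, c.pol, c.mem)) (by
    rintro ⟨q, p, V⟩ ⟨q', p', V'⟩ h
    simpa using h)

/-- In a sequence over a finite type, eventually only values occurring infinitely often occur. -/
theorem eventually_frequently_eq {α : Type*} [Finite α] (u : ℕ → α) :
    ∀ᶠ n in atTop, ∃ᶠ m in atTop, u m = u n := by
  have h : ∀ᶠ n in atTop, ∀ a : α, (¬ ∃ᶠ m in atTop, u m = a) → u n ≠ a := by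
    refine eventually_all.2 fun a => ?_
    by_cases ha : ∃ᶠ m in atTop, u m = a
    · exact Eventually.of_forall fun _ h => absurd ha h
    · exact (not_frequently.1 ha).mono fun _ h _ => h
  filter_upwards [h] with n hn
  by_contra hc
  exact hn _ hc rfl

/-- Lexicographic enumeration of the positions `(n, k)` with `k < len n`. -/
theorem exists_lex_enumeration (len : ℕ → ℕ) (hlen : ∀ n, 0 < len n) :
    ∃ pos : ℕ → ℕ × ℕ, pos.Injective ∧ Set.range pos = {p | p.2 < len p.1} ∧
      ∀ m, ((pos m).2 + 1 < len (pos m).1 ∧ pos (m + 1) = ((pos m).1, (pos m).2 + 1)) ∨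
        ((pos m).2 + 1 = len (pos m).1 ∧ pos (m + 1) = ((pos m).1 + 1, 0)) := by
  let next : ℕ × ℕ → ℕ × ℕ := fun p => if p.2 + 1 < len p.1 then (p.1, p.2 + 1) else (p.1 + 1, 0)
  let pos : ℕ → ℕ × ℕ := fun m => next^[m] (0, 0)
  have hsucc : ∀ m, pos (m + 1) = next (pos m) := fun m => Function.iterate_succ_apply' _ _ _
  have hvalid : ∀ m, (pos m).2 < len (pos m).1 := by
    intro m
    induction m with
    | zero => exact hlen 0
    | succ m ih =>
      rw [hsucc]
      by_cases h : (pos m).2 + 1 < len (pos m).1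
      · simp [next, h]
      · simpa [next, h] using hlen _
  have hstep : ∀ m,
      ((pos m).2 + 1 < len (pos m).1 ∧ pos (m + 1) = ((pos m).1, (pos m).2 + 1)) ∨
        ((pos m).2 + 1 = len (pos m).1 ∧ pos (m + 1) = ((pos m).1 + 1, 0)) := by
    intro m
    by_cases h : (pos m).2 + 1 < len (pos m).1
    · exact Or.inl ⟨h, by simp [hsucc, next, h]⟩
    · exact Or.inr ⟨by have := hvalid m; omega, by simp [hsucc, next, h]⟩
  let idx : ℕ × ℕ → ℕ := fun p => ∑ i ∈ Finset.range p.1, len i + p.2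
  have hidx : Function.LeftInverse idx pos := by
    intro m
    induction m with
    | zero => rfl
    | succ m ih =>
      simp only [idx] at ih
      rcases hstep m with ⟨-, h⟩ | ⟨h', h⟩
      · simp only [h, idx]
        omega
      · simp only [h, idx, Finset.sum_range_succ]
        omega
  refine ⟨pos, hidx.injective, Set.Subset.antisymm ?_ ?_, hstep⟩
  · rintro _ ⟨m, rfl⟩
    exact hvalid m
  · have hrow : ∀ n, (n, 0) ∈ Set.range pos → ∀ k, k < len n → (n, k) ∈ Set.range pos := by
      intro n hn k
      induction k with
      | zero => exact fun _ => hn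
      | succ k ih =>
        intro hk
        obtain ⟨m, hm⟩ := ih (by omega)
        exact ⟨m + 1, by simp [hsucc, next, hm, hk]⟩
    have hstart : ∀ n, (n, 0) ∈ Set.range pos := by
      intro n
      induction n with
      | zero => exact ⟨0, rfl⟩
      | succ n ih =>
        have := hlen n
        obtain ⟨m, hm⟩ := hrow n ih (len n - 1) (by omega)
        exact ⟨m + 1, by simp [hsucc, next, hm, show ¬ len n - 1 + 1 < len n by omega]⟩
    rintro ⟨n, k⟩ hk
    exact hrow n (hstart n) k hk

namespace NavTask

variable {Q A : Type}

/-- The concatenation of the trials of a run into one sequence of transitions; reward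
transitions are exactly those after which the working memory is reset. -/
structure IsStepSeq (T : NavTask Q A) (σ : ℕ → Step Q A) : Prop where
  valid : ∀ n, T.ValidStep (σ n)
  src_succ : ∀ n, ¬ T.IsRewardStep (σ n) → (σ (n + 1)).src = (σ n).tgt
  mem_succ : ∀ n, T.IsRewardStep (σ n) → (σ (n + 1)).src.mem = ∅
  pol_succ : ∀ n, T.IsRewardStep (σ n) → (σ (n + 1)).src.pol = (σ n).tgt.pol

theorem IsRun.exists_isStepSeq {T : NavTask Q A} {R : Run Q A} (hR : T.IsRun R) :
    ∃ σ, T.IsStepSeq σ ∧ ∀ P, R.InfOften P ↔ ∃ᶠ n in atTop, P (σ n) := by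
  cases R with
  | withInf L g =>
    obtain ⟨-, ⟨hv, hc, hr⟩, -⟩ := hR
    refine ⟨g, ⟨hv, fun n _ => (hc n).symm, fun n h => absurd h (hr n),
      fun n h => absurd h (hr n)⟩, fun P => ?_⟩
    simp [Run.InfOften, Run.InfOftenFrom, Nat.frequently_atTop_iff_infinite]
  | allFin f =>
    obtain ⟨hfin, -, hsucc, -⟩ := hR
    have hlen : ∀ n, 0 < (f n).length := fun n => List.length_pos_of_ne_nil (hfin n).1
    obtain ⟨pos, hinj, hrange, hstep⟩ := exists_lex_enumeration (fun n => (f n).length) hlen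
    have hpos : ∀ m, (pos m).2 < (f (pos m).1).length := fun m => by
      have : pos m ∈ {p : ℕ × ℕ | p.2 < (f p.1).length} := hrange ▸ Set.mem_range_self m
      exact this
    let stepAt : ℕ × ℕ → Option (Step Q A) := fun p => (f p.1)[p.2]?
    let σ : ℕ → Step Q A := fun m => (f (pos m).1)[(pos m).2]'(hpos m)
    have hσ : ∀ m, stepAt (pos m) = some (σ m) := fun m => List.getElem?_eq_getElem (hpos m)
    have hinner : ∀ m, (pos m).2 + 1 < (f (pos m).1).length →
        pos (m + 1) = ((pos m).1, (pos m).2 + 1) →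
        ¬ T.IsRewardStep (σ m) ∧ (σ (m + 1)).src = (σ m).tgt := by
      intro m h hm
      refine ⟨(hfin _).2.2.2.2 _ h, ?_⟩
      have h1 := hσ (m + 1)
      simp only [hm, stepAt, List.getElem?_eq_getElem h, Option.some.injEq] at h1
      rw [← h1]
      exact ((hfin _).2.1 _ h).symm
    have hlast : ∀ m, (pos m).2 + 1 = (f (pos m).1).length →
        pos (m + 1) = ((pos m).1 + 1, 0) →
        T.IsRewardStep (σ m) ∧ T.Succession (σ m).tgt (σ (m + 1)).src := by
      intro m h hm
      have hl : (f (pos m).1).getLast? = some (σ m) := by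
        rw [List.getLast?_eq_getElem?, ← hσ m]
        simp only [stepAt]
        congr 1
        omega
      have hf : (f ((pos m).1 + 1)).head? = some (σ (m + 1)) := by
        rw [List.head?_eq_getElem?, ← hσ (m + 1), hm]
      exact ⟨(hfin _).2.2.2.1 _ hl,
        hsucc (pos m).1 _ (by simp [lastTgt?, hl]) _ (by simp [firstSrc?, hf])⟩
    refine ⟨σ, ⟨fun m => (hfin _).2.2.1 _ (List.getElem_mem _), fun m h => ?_, fun m h => ?_,
      fun m h => ?_⟩, fun P => ?_⟩
    · rcases hstep m with ⟨h', hm⟩ | ⟨h', hm⟩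
      · exact (hinner m h' hm).2
      · exact absurd (hlast m h' hm).1 h
    · rcases hstep m with ⟨h', hm⟩ | ⟨h', hm⟩
      · exact absurd h (hinner m h' hm).1
      · exact (hlast m h' hm).2.2.2
    · rcases hstep m with ⟨h', hm⟩ | ⟨h', hm⟩
      · exact absurd h (hinner m h' hm).1
      · exact (hlast m h' hm).2.2.1
    · rw [Nat.frequently_atTop_iff_infinite, ← Set.infinite_image_iff hinj.injOn]
      have : {p : ℕ × ℕ | 0 ≤ p.1 ∧ ∃ h : p.2 < (f p.1).length, P ((f p.1)[p.2]'h)} =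
          pos '' {m | P (σ m)} := by
        ext p
        constructor
        · rintro ⟨-, h, hP⟩
          obtain ⟨m, rfl⟩ : p ∈ Set.range pos := hrange ▸ h
          exact ⟨m, hP, rfl⟩
        · rintro ⟨m, hP, rfl⟩
          exact ⟨Nat.zero_le _, hpos m, hP⟩
      simp only [Run.InfOften, Run.InfOftenFrom]
      rw [this]

/-- The policy assigns `a` to `q` and, if `q` was visited in the current trial, then this trial
has moved on to some successor in `δ(q, a)` without reward. -/
def FollowsAt (T : NavTask Q A) (q : Q) (a : A) (c : Config Q A) : Prop :=
  c.pol q = a ∧ (q ∈ c.mem →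
    (q, a) ∉ T.rewards ∧ ∃ s ∈ T.delta q a, s ∈ c.mem ∨ s = c.state)

namespace IsStepSeq

variable {T : NavTask Q A} {σ : ℕ → Step Q A}

theorem pol_succ_eq (hσ : T.IsStepSeq σ) (n : ℕ) : (σ (n + 1)).src.pol = (σ n).tgt.pol := by
  by_cases h : T.IsRewardStep (σ n)
  · exact hσ.pol_succ n h
  · rw [hσ.src_succ n h]

/-- Performing `a` in `q` establishes `FollowsAt`. -/
theorem followsAt_of_act (hσ : T.IsStepSeq σ) {q : Q} {a : A} {n : ℕ}
    (hq : (σ n).src.state = q) (ha : (σ n).act = a) : T.FollowsAt q a (σ (n + 1)).src := by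
  subst hq ha
  obtain ⟨⟨-, hd⟩, ht⟩ := hσ.valid n
  refine ⟨by rw [hσ.pol_succ_eq, ht, Config.apply_pol_self], fun hm => ?_⟩
  by_cases h : T.IsRewardStep (σ n)
  · rw [hσ.mem_succ n h] at hm
    exact absurd hm (Set.notMem_empty _)
  · refine ⟨h, (σ n).nxt, hd, Or.inr ?_⟩
    rw [hσ.src_succ n h, ht]
    rfl

/-- `FollowsAt` persists as long as `q` does not branch. -/
theorem followsAt_succ (hσ : T.IsStepSeq σ) {q : Q} {a : A} {n : ℕ}
    (h : T.FollowsAt q a (σ n).src)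
    (hb : ¬ ((σ n).src.state = q ∧ (σ n).src.Branching)) :
    T.FollowsAt q a (σ (n + 1)).src := by
  obtain ⟨⟨hact, -⟩, ht⟩ := hσ.valid n
  by_cases hq : (σ n).src.state = q
  · refine hσ.followsAt_of_act hq ?_
    have := hact.resolve_left fun hbr => hb ⟨hq, hbr⟩
    simpa [hq, h.1] using this
  · refine ⟨by rw [hσ.pol_succ_eq, ht, Config.apply_pol_of_ne _ _ _ (Ne.symm hq), h.1],
      fun hm => ?_⟩
    by_cases hr : T.IsRewardStep (σ n)
    · rw [hσ.mem_succ n hr] at hm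
      exact absurd hm (Set.notMem_empty _)
    · rw [hσ.src_succ n hr, ht] at hm ⊢
      obtain ⟨hrew, s, hs, hs'⟩ := h.2 (hm.resolve_right (Ne.symm hq))
      exact ⟨hrew, s, hs, Or.inl hs'⟩

/-- In a fair sequence, a state stabilizes if some action is rewarded there or leads only to
states that stabilize. -/
theorem not_frequently_branching [Finite Q] [Finite A] (hσ : T.IsStepSeq σ)
    (hfair : ∀ c, (∃ᶠ n in atTop, (σ n).src = c) → ∀ p ∈ T.opts c,
      ∃ᶠ n in atTop, σ n = ⟨c, p.1, p.2, c.apply p.1 p.2⟩)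
    {q : Q} {a : A}
    (h : (q, a) ∈ T.rewards ∨ ∀ s ∈ T.delta q a,
      ¬ ∃ᶠ n in atTop, (σ n).src.state = s ∧ (σ n).src.Branching) :
    ¬ ∃ᶠ n in atTop, (σ n).src.state = q ∧ (σ n).src.Branching := by
  intro hinf
  obtain ⟨N, hN⟩ := eventually_atTop.1 (eventually_frequently_eq fun n => (σ n).src)
  obtain ⟨m, hm, hmq, hmb⟩ := frequently_atTop.1 hinf N
  obtain ⟨s₀, hs₀⟩ := T.delta_nonempty q a
  obtain ⟨t, htN, ht⟩ := frequently_atTop.1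
    (hfair _ (hN m hm) (a, s₀) ⟨Or.inl hmb, by rw [hmq]; exact hs₀⟩) N
  have hfollow : T.FollowsAt q a (σ (t + 1)).src :=
    hσ.followsAt_of_act (by rw [ht]; exact hmq) (by rw [ht])
  have hnext : ∃ k, (σ (t + 1 + k)).src.state = q ∧ (σ (t + 1 + k)).src.Branching := by
    obtain ⟨n, hn, hn'⟩ := frequently_atTop.1 hinf (t + 1)
    exact ⟨n - (t + 1), by rwa [Nat.add_sub_cancel' hn]⟩
  classical
  obtain ⟨hkq, hkb⟩ := Nat.find_spec hnext
  have hk : ∀ j ≤ Nat.find hnext, T.FollowsAt q a (σ (t + 1 + j)).src := by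
    intro j
    induction j with
    | zero => exact fun _ => hfollow
    | succ j ih => exact fun hj => hσ.followsAt_succ (ih (by omega)) (Nat.find_min hnext hj)
  obtain ⟨-, hmem⟩ := hk _ le_rfl
  set n := t + 1 + Nat.find hnext with hn
  have hqmem : q ∈ (σ n).src.mem := hkq ▸ hkb
  obtain ⟨hrew, s, hs, hs'⟩ := hmem hqmem
  have hsmem : s ∈ (σ n).src.mem := hs'.elim id fun e => by rw [e, hkq]; exact hqmem
  have htake := hfair _ (hN n (by omega)) (a, s) ⟨Or.inl hkb, by rw [hkq]; exact hs⟩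
  refine h.resolve_left hrew s hs ?_
  refine (tendsto_add_atTop_nat 1).frequently (htake.mono fun i hi => ?_)
  have hnr : ¬ T.IsRewardStep (σ i) := by
    rw [hi, IsRewardStep, hkq]
    exact hrew
  rw [hσ.src_succ i hnr, hi]
  exact ⟨rfl, Or.inl hsmem⟩

end IsStepSeq

end NavTask

/-- In a fair run on a reducible task, every state eventually
becomes stable. -/
theorem all_states_stable {Q A : Type} [Fintype Q] [Fintype A]
    (T : NavTask Q A) (hred : T.Reducible)
    (R : Run Q A) (hrun : T.IsRun R) (hfair : T.Fair R) :
    ∀ q : Q, R.Stable q := by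
  obtain ⟨σ, hσ, hio⟩ := hrun.exists_isStepSeq
  have hfair' : ∀ c, (∃ᶠ n in atTop, (σ n).src = c) → ∀ p ∈ T.opts c,
      ∃ᶠ n in atTop, σ n = ⟨c, p.1, p.2, c.apply p.1 p.2⟩ :=
    fun c hc p hp => (hio _).1 (hfair c ((hio _).2 hc) p hp)
  have hlayer : ∀ n, ∀ q ∈ T.layers T.goals n,
      ¬ ∃ᶠ m in atTop, (σ m).src.state = q ∧ (σ m).src.Branching := by
    intro n
    induction n with
    | zero => exact fun q ⟨a, ha⟩ => hσ.not_frequently_branching hfair' (Or.inl ha)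
    | succ n ih =>
      rintro q (hq | ⟨a, ha⟩)
      · exact ih q hq
      · exact hσ.not_frequently_branching hfair' (Or.inr fun s hs => ih s (ha hs))
  intro q
  obtain ⟨n, hn⟩ := Set.mem_iUnion.1 (hred (Set.mem_univ q))
  exact fun h => hlayer n q hn ((hio _).1 h)
end

section
/- Let T = (Q, Q₀, A, rewards, δ) be a reducible task and let R be a fair run on T. Then only finitely many trials of R contain more non-terminal configurations than |Q|; equivalently, there is a trial index after which every trial contains at most |Q| non-terminal configurations. -/
open Filter

section

variable {Q A : Type}

instance Config.finite [Finite Q] [Finite A] : Finite (Config Q A) :=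
  Finite.of_injective (fun c : Config Q A => (c.state, c.pol, c.mem)) fun c d h => by
    cases c; cases d; simpa using h

/-- In a run of finite trials, a property holds infinitely often iff it holds somewhere in
infinitely many trials. -/
theorem Run.infOften_allFin_iff (f : ℕ → List (Step Q A)) (P : Step Q A → Prop) :
    (Run.allFin f).InfOften P ↔
      ∃ᶠ m in atTop, ∃ i, ∃ h : i < (f m).length, P ((f m)[i]'h) := by
  constructor
  · intro hinf hev
    rw [eventually_atTop] at hev
    obtain ⟨M, hM⟩ := hev
    refine hinf (((Set.finite_lt_nat M).biUnion (t := fun m => (fun i => (m, i)) ''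
      {i | i < (f m).length}) fun m _ => (Set.finite_lt_nat _).image _).subset ?_)
    rintro ⟨m, i⟩ ⟨-, h, hP⟩
    have hm : m < M := by
      by_contra hle
      exact hM m (not_lt.mp hle) ⟨i, h, hP⟩
    exact Set.mem_biUnion (show m ∈ {n | n < M} from hm) ⟨i, h, rfl⟩
  · intro hfreq
    rw [Nat.frequently_atTop_iff_infinite] at hfreq
    refine Set.Infinite.of_image Prod.fst (hfreq.mono ?_)
    rintro m ⟨i, h, hP⟩
    exact ⟨(m, i), ⟨Nat.zero_le _, h, hP⟩, rfl⟩

namespace NavTask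

variable {T : NavTask Q A}

theorem ValidStep.tgt_state {t : Step Q A} (h : T.ValidStep t) : t.tgt.state = t.nxt := by
  rw [h.2]; rfl

theorem ValidStep.tgt_mem {t : Step Q A} (h : T.ValidStep t) :
    t.tgt.mem = t.src.mem ∪ {t.src.state} := by
  rw [h.2]; rfl

theorem ValidStep.tgt_pol_of_eq {t : Step Q A} (h : T.ValidStep t) {q : Q}
    (hq : t.src.state = q) : t.tgt.pol q = t.act := by
  rw [h.2]; simp [Config.apply, hq]

theorem ValidStep.tgt_pol_of_ne {t : Step Q A} (h : T.ValidStep t) {q : Q}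
    (hq : t.src.state ≠ q) : t.tgt.pol q = t.src.pol q := by
  rw [h.2]; simp [Config.apply, hq.symm]

theorem ValidStep.act_eq {t : Step Q A} (h : T.ValidStep t) (hb : ¬ t.src.Branching) :
    t.act = t.src.pol t.src.state :=
  h.1.1.resolve_left hb

namespace IsFinTrial

variable {l : List (Step Q A)}

theorem length_pos (h : T.IsFinTrial l) : 0 < l.length := List.length_pos_iff.mpr h.1

theorem validStep (h : T.IsFinTrial l) {i : ℕ} (hi : i < l.length) : T.ValidStep l[i] :=
  h.2.2.1 _ (List.getElem_mem hi)

theorem src_succ (h : T.IsFinTrial l) {i : ℕ} (hi : i + 1 < l.length) :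
    (l[i + 1]'hi).src = l[i].tgt := (h.2.1 i hi).symm

theorem lt_of_not_isRewardStep (h : T.IsFinTrial l) {i : ℕ} (hi : i < l.length)
    (hr : ¬ T.IsRewardStep l[i]) : i + 1 < l.length := by
  by_contra hlt
  refine hr (h.2.2.2.1 _ ?_)
  have : l.length - 1 = i := by omega
  simp [List.getLast?_eq_getElem?, this, hi]

theorem state_mem (h : T.IsFinTrial l) {i j : ℕ} (hij : i < j) (hj : j < l.length) :
    (l[i]'(hij.trans hj)).src.state ∈ l[j].src.mem := by
  induction j, hij using Nat.le_induction with
  | base => rw [h.src_succ hj, (h.validStep _).tgt_mem]; exact Or.inr rfl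
  | succ j hij ih =>
    rw [h.src_succ hj, (h.validStep _).tgt_mem]
    exact Or.inl (ih (Nat.lt_of_succ_lt hj))

/-- If `a` is chosen at `q` and `q` does not recur, the policy at `q` remains `a`. -/
theorem tgt_pol_of_not_recur (h : T.IsFinTrial l) {q : Q} {a : A} {i : ℕ}
    (hi : i < l.length) (hs : l[i].src.state = q) (ha : l[i].act = a)
    (hrec : ∀ j (hj : j < l.length), i < j → l[j].src.state ≠ q)
    {j : ℕ} (hij : i ≤ j) (hj : j < l.length) : l[j].tgt.pol q = a := by
  induction j, hij using Nat.le_induction with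
  | base => rw [(h.validStep _).tgt_pol_of_eq hs, ha]
  | succ j hij ih =>
    rw [(h.validStep _).tgt_pol_of_ne (hrec _ hj (by omega)), h.src_succ hj]
    exact ih _

/-- A trial that starts with policy `a` at `q`, and in which `q` does not recur after
`a` is chosen there, never branches at `q` and preserves the policy at `q`. -/
theorem not_branching_and_tgt_pol (h : T.IsFinTrial l) {q : Q} {a : A}
    (hmem : (l[0]'h.length_pos).src.mem = ∅) (hpol : (l[0]'h.length_pos).src.pol q = a)
    (hrec : ∀ i j (hij : i < j) (hj : j < l.length), (l[i]'(hij.trans hj)).src.state = q →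
      (l[i]'(hij.trans hj)).act = a → l[j].src.state ≠ q)
    (j : ℕ) (hj : j < l.length) :
    (l[j].src.state = q → ¬ l[j].src.Branching) ∧ l[j].tgt.pol q = a := by
  have step : ∀ j (hj : j < l.length), l[j].src.pol q = a →
      (q ∈ l[j].src.mem → ∃ i, ∃ hij : i < j, (l[i]'(hij.trans hj)).src.state = q ∧
        (l[i]'(hij.trans hj)).act = a) →
      (l[j].src.state = q → ¬ l[j].src.Branching ∧ l[j].act = a) := by
    intro j hj hp hm hs
    have hb : ¬ l[j].src.Branching := fun hb => by
      obtain ⟨i, hij, hi, hia⟩ := hm (hs ▸ hb)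
      exact hrec i j hij hj hi hia hs
    exact ⟨hb, by rw [(h.validStep hj).act_eq hb, hs, hp]⟩
  have tgt_pol : ∀ j (hj : j < l.length), l[j].src.pol q = a →
      (l[j].src.state = q → ¬ l[j].src.Branching ∧ l[j].act = a) → l[j].tgt.pol q = a := by
    intro j hj hp hs
    by_cases hq : l[j].src.state = q
    · rw [(h.validStep hj).tgt_pol_of_eq hq, (hs hq).2]
    · rw [(h.validStep hj).tgt_pol_of_ne hq, hp]
  have inv : ∀ j (hj : j < l.length), l[j].src.pol q = a ∧
      (q ∈ l[j].src.mem → ∃ i, ∃ hij : i < j, (l[i]'(hij.trans hj)).src.state = q ∧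
        (l[i]'(hij.trans hj)).act = a) := by
    intro j
    induction j with
    | zero => intro hj; exact ⟨hpol, fun hq => by simp [hmem] at hq⟩
    | succ j ih =>
      intro hj
      obtain ⟨hp, hm⟩ := ih (Nat.lt_of_succ_lt hj)
      have hs := step j _ hp hm
      refine ⟨by rw [h.src_succ hj]; exact tgt_pol j _ hp hs, ?_⟩
      rw [h.src_succ hj, (h.validStep _).tgt_mem]
      rintro (hq | hq)
      · obtain ⟨i, hij, hi⟩ := hm hq
        exact ⟨i, hij.trans (Nat.lt_succ_self j), hi⟩
      · have hq : _ = q := (Set.mem_singleton_iff.mp hq).symm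
        exact ⟨j, Nat.lt_succ_self j, hq, (hs hq).2⟩
  obtain ⟨hp, hm⟩ := inv j hj
  have hs := step j hj hp hm
  exact ⟨fun hq => (hs hq).1, tgt_pol j hj hp hs⟩

theorem exists_branching [Fintype Q] (h : T.IsFinTrial l) (hl : Fintype.card Q < l.length) :
    ∃ j, ∃ hj : j < l.length, l[j].src.Branching := by
  obtain ⟨i, j, hne, heq⟩ := Fintype.exists_ne_map_eq_of_card_lt
    (fun i : Fin l.length => l[i].src.state) (by simpa using hl)
  simp only [Fin.getElem_fin] at heq
  rcases lt_or_gt_of_ne hne with hij | hij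
  · exact ⟨j, j.2, by rw [Config.Branching, ← heq]; exact h.state_mem hij j.2⟩
  · exact ⟨i, i.2, by rw [Config.Branching, heq]; exact h.state_mem hij i.2⟩

end IsFinTrial

section allFin

variable {f : ℕ → List (Step Q A)}

theorem IsRun.src_zero_mem (hrun : T.IsRun (.allFin f)) (m : ℕ) :
    ((f m)[0]'(hrun.1 m).length_pos).src.mem = ∅ := by
  have hfirst : ∀ m, ((f m)[0]'(hrun.1 m).length_pos).src ∈ firstSrc? (f m) := fun m => by
    simp [firstSrc?, List.head?_eq_getElem?, (hrun.1 m).length_pos]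
  cases m with
  | zero => exact (hrun.2.1 _ (hfirst 0)).2
  | succ m =>
    refine (hrun.2.2.1 m ((f m).getLast (hrun.1 m).1).tgt ?_ _ (hfirst _)).2.2
    simp [lastTgt?, List.getLast?_eq_some_getLast (hrun.1 m).1]

theorem IsRun.src_zero_pol_succ (hrun : T.IsRun (.allFin f)) (m : ℕ) :
    ((f (m + 1))[0]'(hrun.1 _).length_pos).src.pol =
      ((f m)[(f m).length - 1]'(Nat.sub_one_lt (hrun.1 m).length_pos.ne')).tgt.pol := by
  refine (hrun.2.2.1 m _ ?_ _ ?_).2.1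
  · have := (hrun.1 m).length_pos
    simp [lastTgt?, List.getLast?_eq_getElem?, this]
  · simp [firstSrc?, List.head?_eq_getElem?, (hrun.1 (m + 1)).length_pos]

/-- Non-reward successors of configurations that occur infinitely often do so as well. -/
theorem Fair.infOften_apply (hfair : T.Fair (.allFin f)) (hrun : T.IsRun (.allFin f))
    {c : Config Q A} (hc : (Run.allFin f).InfOften fun t => t.src = c) {a : A} {q : Q}
    (hp : (a, q) ∈ T.opts c) (hr : (c.state, a) ∉ T.rewards) :
    (Run.allFin f).InfOften fun t => t.src = c.apply a q := by
  have hstep := hfair c hc _ hp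
  rw [Run.infOften_allFin_iff] at hstep ⊢
  refine hstep.mono ?_
  rintro m ⟨i, hi, heq⟩
  have hi' := (hrun.1 m).lt_of_not_isRewardStep hi (by rw [heq]; exact hr)
  exact ⟨i + 1, hi', by rw [(hrun.1 m).src_succ hi', heq]⟩

theorem eventually_infOften [Finite Q] [Finite A] (f : ℕ → List (Step Q A)) :
    ∀ᶠ m in atTop, ∀ i, ∀ h : i < (f m).length,
      (Run.allFin f).InfOften fun t => t.src = ((f m)[i]'h).src := by
  have hall : ∀ᶠ m in atTop, ∀ c : Config Q A,
      (∃ i, ∃ h : i < (f m).length, ((f m)[i]'h).src = c) →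
        (Run.allFin f).InfOften fun t => t.src = c := by
    rw [eventually_all]
    intro c
    by_cases hc : (Run.allFin f).InfOften fun t => t.src = c
    · exact .of_forall fun _ _ => hc
    · have hc' := hc
      rw [Run.infOften_allFin_iff, not_frequently] at hc'
      exact hc'.mono fun _ hm h => absurd h hm
  exact hall.mono fun m hm i h => hm _ ⟨i, h, rfl⟩

/-- A state having an action that is rewarding or leads only to states where no branching
configuration occurs infinitely often has itself no such configuration. -/
theorem Fair.not_branching_of_action [Finite Q] [Finite A] (hfair : T.Fair (.allFin f))
    (hrun : T.IsRun (.allFin f)) {q : Q} {a : A}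
    (ha : (q, a) ∈ T.rewards ∨ ∀ q' ∈ T.delta q a, ∀ c : Config Q A,
      ((Run.allFin f).InfOften fun t => t.src = c) → c.state = q' → ¬ c.Branching)
    {c : Config Q A} (hc : (Run.allFin f).InfOften fun t => t.src = c) (hq : c.state = q) :
    ¬ c.Branching := by
  intro hb
  obtain ⟨N, hN⟩ := eventually_atTop.mp (eventually_infOften f)
  have hrec : ∀ m, N ≤ m → ∀ i j (hij : i < j) (hj : j < (f m).length),
      ((f m)[i]'(hij.trans hj)).src.state = q → ((f m)[i]'(hij.trans hj)).act = a →
        (f m)[j].src.state ≠ q := by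
    intro m hm i j hij hj hsi hai hsj
    have htr := hrun.1 m
    have hi1 : i + 1 < (f m).length := by omega
    have hnr : (q, a) ∉ T.rewards := by
      have := htr.2.2.2.2 i hi1
      rwa [IsRewardStep, hsi, hai] at this
    have hv := htr.validStep (hij.trans hj)
    have hdelta : ((f m)[i]'(hij.trans hj)).nxt ∈ T.delta q a := by
      have := hv.1.2
      rwa [hsi, hai] at this
    have hbj : (f m)[j].src.Branching := by
      rw [Config.Branching, hsj, ← hsi]; exact htr.state_mem hij hj
    refine ha.resolve_left hnr _ hdelta _ (hfair.infOften_apply hrun (hN m hm j hj)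
      (a := a) (q := ((f m)[i]'(hij.trans hj)).nxt) ⟨Or.inl hbj, by rwa [hsj]⟩
      (by rwa [hsj])) rfl ?_
    change _ ∈ _ ∪ _
    have hnext : ((f m)[i]'(hij.trans hj)).nxt = ((f m)[i + 1]'hi1).src.state := by
      rw [htr.src_succ hi1, hv.tgt_state]
    rw [hnext]
    rcases Nat.lt_or_eq_of_le (Nat.succ_le_of_lt hij) with hlt | rfl
    · exact Or.inl (htr.state_mem hlt hj)
    · exact Or.inr rfl
  obtain ⟨q', hq'⟩ := T.delta_nonempty q a
  have hstep := hfair c hc (a, q') ⟨Or.inl hb, by rwa [hq]⟩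
  rw [Run.infOften_allFin_iff, frequently_atTop] at hstep
  obtain ⟨m, hm, i, hi, heq⟩ := hstep N
  have hend : ((f m)[(f m).length - 1]'(Nat.sub_one_lt (hrun.1 m).length_pos.ne')).tgt.pol q
      = a :=
    have hs : ((f m)[i]'hi).src.state = q := by rw [heq]; exact hq
    have hact : ((f m)[i]'hi).act = a := by rw [heq]
    (hrun.1 m).tgt_pol_of_not_recur hi hs hact
      (fun j hj hij => hrec m hm i j hij hj hs hact) (by omega) _
  have hpol : ∀ n, m + 1 ≤ n → ((f n)[0]'(hrun.1 n).length_pos).src.pol q = a := by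
    intro n hn
    induction n, hn using Nat.le_induction with
    | base => rw [hrun.src_zero_pol_succ, hend]
    | succ n hn ih =>
      rw [hrun.src_zero_pol_succ]
      exact ((hrun.1 n).not_branching_and_tgt_pol (hrun.src_zero_mem n) ih
        (hrec n (by omega)) _ _).2
  rw [Run.infOften_allFin_iff, frequently_atTop] at hc
  obtain ⟨n, hn, j, hj, rfl⟩ := hc (m + 1)
  exact ((hrun.1 n).not_branching_and_tgt_pol (hrun.src_zero_mem n) (hpol n hn)
    (hrec n (by omega)) j hj).1 hq hb

theorem Fair.not_branching_of_mem_layers [Finite Q] [Finite A] (hfair : T.Fair (.allFin f))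
    (hrun : T.IsRun (.allFin f)) (n : ℕ) : ∀ q ∈ T.layers T.goals n, ∀ c : Config Q A,
      ((Run.allFin f).InfOften fun t => t.src = c) → c.state = q → ¬ c.Branching := by
  induction n with
  | zero =>
    rintro q ⟨a, ha⟩ c hc hq
    exact hfair.not_branching_of_action hrun (Or.inl ha) hc hq
  | succ n ih =>
    rintro q (hq | ⟨a, ha⟩) c hc hcq
    · exact ih q hq c hc hcq
    · exact hfair.not_branching_of_action hrun (Or.inr fun q' hq' => ih q' (ha hq')) hc hcq

end allFin

section withInf

variable {L : List (List (Step Q A))} {g : ℕ → Step Q A}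

theorem IsInfTrial.state_mem (h : T.IsInfTrial g) {i j : ℕ} (hij : i < j) :
    (g i).src.state ∈ (g j).src.mem := by
  induction j, hij using Nat.le_induction with
  | base => rw [← h.2.1, (h.1 _).tgt_mem]; exact Or.inr rfl
  | succ j hij ih => rw [← h.2.1, (h.1 _).tgt_mem]; exact Or.inl ih

theorem IsInfTrial.branching_of_infinite (h : T.IsInfTrial g) {c : Config Q A}
    (hc : {n | (g n).src = c}.Infinite) : c.Branching := by
  obtain ⟨i, rfl⟩ := hc.nonempty
  obtain ⟨j, hj, hij⟩ := hc.exists_gt i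
  have hmem := h.state_mem hij
  rwa [show (g j).src = (g i).src from hj] at hmem

theorem Fair.state_notMem_layers (hfair : T.Fair (.withInf L g)) (h : T.IsInfTrial g)
    (n : ℕ) : ∀ c : Config Q A, {n | (g n).src = c}.Infinite →
      c.state ∉ T.layers T.goals n := by
  have hopt : ∀ c : Config Q A, {n | (g n).src = c}.Infinite → ∀ a, ∀ q' ∈ T.delta c.state a,
      {n | g n = ⟨c, a, q', c.apply a q'⟩}.Infinite := fun c hc a q' hq' =>
    (hfair c ⟨Nat.zero_le _, hc⟩ (a, q') ⟨Or.inl (h.branching_of_infinite hc), hq'⟩).2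
  induction n with
  | zero =>
    rintro c hc ⟨a, ha⟩
    obtain ⟨q', hq'⟩ := T.delta_nonempty c.state a
    obtain ⟨i, hi⟩ := (hopt c hc a q' hq').nonempty
    refine h.2.2 i ?_
    rw [show g i = _ from hi]
    exact ha
  | succ n ih =>
    rintro c hc (hq | ⟨a, ha⟩)
    · exact ih c hc hq
    · obtain ⟨q', hq'⟩ := T.delta_nonempty c.state a
      refine ih (c.apply a q') ?_ (ha hq')
      refine ((hopt c hc a q' hq').image (Nat.succ_injective.injOn)).mono ?_
      rintro _ ⟨i, hi, rfl⟩
      change (g (i + 1)).src = _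
      rw [← h.2.1, show g i = _ from hi]

end withInf

theorem Reducible.exists_mem_layers (hred : T.Reducible) (q : Q) :
    ∃ n, q ∈ T.layers T.goals n :=
  Set.mem_iUnion.mp (hred (Set.mem_univ q))

end NavTask

end

/-- In a fair run on a reducible task, only finitely many trials
contain more than `|Q|` non-terminal configurations. -/
theorem eventually_short_trials {Q A : Type} [Fintype Q] [Fintype A]
    (T : NavTask Q A) (hred : T.Reducible)
    (R : Run Q A) (hrun : T.IsRun R) (hfair : T.Fair R) :
    R.EventuallyBounded (Fintype.card Q) := by
  cases R with
  | allFin f =>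
    obtain ⟨N, hN⟩ := eventually_atTop.mp (NavTask.eventually_infOften f)
    refine (Set.finite_lt_nat N).subset fun m hm => ?_
    by_contra hle
    obtain ⟨j, hj, hb⟩ := (hrun.1 m).exists_branching hm
    obtain ⟨n, hn⟩ := hred.exists_mem_layers ((f m)[j]'hj).src.state
    exact hfair.not_branching_of_mem_layers hrun n _ hn _ (hN m (not_lt.mp hle) j hj) rfl hb
  | withInf L g =>
    obtain ⟨c, hc⟩ := Finite.exists_infinite_fiber fun n => (g n).src
    obtain ⟨n, hn⟩ := hred.exists_mem_layers c.state
    exact hfair.state_notMem_layers hrun.2.1 n c (Set.infinite_coe_iff.mp hc) hn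
end
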